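/- Let q ≤ n, let f ∈ H_d^ℝ[q] be nonzero, and let x ∈ S^n be such that max{‖f(x)‖₂, σ_q(Δ⁻¹Dₓf)} > 0. Define K(f,x) := √q·‖f‖∞ / max{‖f(x)‖₂, σ_q(Δ⁻¹Dₓf)} and κ(f,x) := ‖f‖_W / (‖f(x)‖₂² + σ_q(Δ^{−1/2}Dₓf)²)^{1/2}. Then ‖f‖∞/‖f‖_W ≤ K(f,x)/κ(f,x) ≤ √(2qD) · ‖f‖∞/‖f‖_W, where D := max_i dᵢ. -/

import Mathlib

open MvPolynomial

noncomputable def vnorm {m : ℕ} (v : Fin m → ℝ) : ℝ := Real.sqrt (∑ j, v j ^ 2)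

noncomputable def polySupNorm {n q : ℕ} (f : Fin q → MvPolynomial (Fin (n + 1)) ℝ) : ℝ :=
  ⨆ x : {x : Fin (n + 1) → ℝ // vnorm x = 1}, ⨆ i : Fin q, |eval x.1 (f i)|

/-- Squared Weyl norm of a real polynomial. -/
noncomputable def weylNormSq {n : ℕ} (f : MvPolynomial (Fin (n + 1)) ℝ) : ℝ :=
  ∑ α ∈ f.support, ((Finsupp.multinomial α : ℝ))⁻¹ * (coeff α f) ^ 2

/-- Weyl norm of a tuple of real polynomials. -/
noncomputable def weylNorm {n q : ℕ} (f : Fin q → MvPolynomial (Fin (n + 1)) ℝ) : ℝ :=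
  Real.sqrt (∑ i, weylNormSq (f i))

/-- The smallest singular value `σ_q(Δ⁻¹Dₓf)` of the scaled derivative of `f` at `x`
restricted to the tangent space `TₓSⁿ = x^⊥`. -/
noncomputable def sigmaMin {n q : ℕ} (d : Fin q → ℕ) (x : Fin (n + 1) → ℝ)
    (f : Fin q → MvPolynomial (Fin (n + 1)) ℝ) : ℝ :=
  ⨅ u : {u : Fin q → ℝ // vnorm u = 1},
    ⨆ w : {w : Fin (n + 1) → ℝ // vnorm w ≤ 1 ∧ ∑ j, w j * x j = 0},
      |∑ i, u.1 i * ((d i : ℝ)⁻¹ * ∑ j, w.1 j * eval x (pderiv j (f i)))|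

/-- The smallest singular value `σ_q(Δ^{-1/2}Dₓf)`. -/
noncomputable def sigmaMinHalf {n q : ℕ} (d : Fin q → ℕ) (x : Fin (n + 1) → ℝ)
    (f : Fin q → MvPolynomial (Fin (n + 1)) ℝ) : ℝ :=
  ⨅ u : {u : Fin q → ℝ // vnorm u = 1},
    ⨆ w : {w : Fin (n + 1) → ℝ // vnorm w ≤ 1 ∧ ∑ j, w j * x j = 0},
      |∑ i, u.1 i * ((Real.sqrt (d i))⁻¹ * ∑ j, w.1 j * eval x (pderiv j (f i)))|

/-- Generic smallest singular value with row weights. -/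
noncomputable def wSig {q : ℕ} {W : Type} (L : Fin q → W → ℝ) (a : Fin q → ℝ) : ℝ :=
  ⨅ u : {u : Fin q → ℝ // vnorm u = 1}, ⨆ w : W, |∑ i, u.1 i * (a i * L i w)|

lemma vnorm_nonneg' {m : ℕ} (v : Fin m → ℝ) : 0 ≤ vnorm v := Real.sqrt_nonneg _

lemma vnorm_smul' {m : ℕ} (c : ℝ) (hc : 0 ≤ c) (v : Fin m → ℝ) :
    vnorm (fun i => c * v i) = c * vnorm v := by
  unfold vnorm
  simp only [mul_pow]
  rw [← Finset.mul_sum, Real.sqrt_mul (sq_nonneg c), Real.sqrt_sq hc]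

lemma wSig_nonneg {q : ℕ} {W : Type} (L : Fin q → W → ℝ) (a : Fin q → ℝ) : 0 ≤ wSig L a :=
  Real.iInf_nonneg fun _ => Real.iSup_nonneg fun _ => abs_nonneg _

lemma wSig_le {q : ℕ} (hq : 1 ≤ q) {W : Type} (L : Fin q → W → ℝ) (a b : Fin q → ℝ) (C : ℝ)
    (hC : 0 < C) (hb : ∀ i, 0 < b i) (hab : ∀ i, b i ≤ C * a i) :
    wSig L b ≤ C * wSig L a := by
  have hne : Nonempty {u : Fin q → ℝ // vnorm u = 1} := by
    refine ⟨⟨Pi.single ⟨0, hq⟩ 1, ?_⟩⟩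
    unfold vnorm
    rw [Finset.sum_eq_single ⟨0, hq⟩]
    · simp
    · intro j _ hj
      simp [hj]
    · simp
  rw [← div_le_iff₀' hC]
  refine le_ciInf fun u => ?_
  obtain ⟨u, hu⟩ := u
  set v : Fin q → ℝ := fun i => a i * u i / b i with hv
  have h1 : 1 ≤ C * vnorm v := by
    rw [← vnorm_smul' C hC.le, ← hu]
    unfold vnorm
    apply Real.sqrt_le_sqrt
    refine Finset.sum_le_sum fun i _ => ?_
    have h2 : C * v i = (C * a i / b i) * u i := by simp only [hv]; ring
    have h3 : 1 ≤ C * a i / b i := by rw [le_div_iff₀ (hb i)]; simpa using hab i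
    beta_reduce
    rw [h2, mul_pow]
    have h4 : (1:ℝ) ≤ (C * a i / b i) ^ 2 := one_le_pow₀ h3
    nlinarith [sq_nonneg (u i)]
  have hvpos : 0 < vnorm v := by
    by_contra h
    nlinarith [vnorm_nonneg' v]
  have hvu : vnorm (fun i => (vnorm v)⁻¹ * v i) = 1 := by
    rw [vnorm_smul' _ (inv_nonneg.2 hvpos.le)]
    exact inv_mul_cancel₀ hvpos.ne'
  have h5 : wSig L b ≤ ⨆ w : W, |∑ i, ((vnorm v)⁻¹ * v i) * (b i * L i w)| := by
    refine ciInf_le (f := fun u : {u : Fin q → ℝ // vnorm u = 1} =>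
      ⨆ w : W, |∑ i, u.1 i * (b i * L i w)|) ⟨0, ?_⟩ ⟨_, hvu⟩
    rintro _ ⟨u, rfl⟩
    exact Real.iSup_nonneg fun _ => abs_nonneg _
  have h6 : (⨆ w : W, |∑ i, ((vnorm v)⁻¹ * v i) * (b i * L i w)|)
      = (vnorm v)⁻¹ * ⨆ w : W, |∑ i, u i * (a i * L i w)| := by
    rw [Real.mul_iSup_of_nonneg (inv_nonneg.2 hvpos.le)]
    congr 1
    ext w
    rw [← abs_of_nonneg (inv_nonneg.2 hvpos.le), ← abs_mul, abs_of_nonneg (inv_nonneg.2 hvpos.le),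
      Finset.mul_sum]
    congr 1
    refine Finset.sum_congr rfl fun i _ => ?_
    have := (hb i).ne'
    simp only [hv]
    field_simp
  rw [h6] at h5
  have h7 : 0 ≤ wSig L b := wSig_nonneg L b
  rw [div_le_iff₀' hC]
  rw [← div_eq_inv_mul, le_div_iff₀ hvpos] at h5
  change wSig L b ≤ C * ⨆ w : W, |∑ i, u i * (a i * L i w)|
  nlinarith

/-- Proposition 4.27: comparison of the `L∞`-based condition number `K(f,x)` with the
Weyl-based condition number `κ(f,x)`. -/
theorem K_kappa_comparison (n q : ℕ) (hn : 1 ≤ n) (hq : 1 ≤ q) (hqn : q ≤ n)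
    (d : Fin q → ℕ) (hd : ∀ i, 1 ≤ d i) (D : ℕ) (hD : D = Finset.univ.sup d)
    (f : Fin q → MvPolynomial (Fin (n + 1)) ℝ) (hf : ∀ i, (f i).IsHomogeneous (d i))
    (hf0 : f ≠ 0) (x : Fin (n + 1) → ℝ) (hx : vnorm x = 1)
    (hΦ : 0 < max (vnorm fun i => eval x (f i)) (sigmaMin d x f)) :
    polySupNorm f / weylNorm f ≤
      (Real.sqrt q * polySupNorm f / max (vnorm fun i => eval x (f i)) (sigmaMin d x f)) /
        (weylNorm f /
          Real.sqrt ((vnorm fun i => eval x (f i)) ^ 2 + sigmaMinHalf d x f ^ 2)) ∧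
    (Real.sqrt q * polySupNorm f / max (vnorm fun i => eval x (f i)) (sigmaMin d x f)) /
        (weylNorm f /
          Real.sqrt ((vnorm fun i => eval x (f i)) ^ 2 + sigmaMinHalf d x f ^ 2)) ≤
      Real.sqrt (2 * q * D) * polySupNorm f / weylNorm f := by
  have hP : 0 ≤ polySupNorm f :=
    Real.iSup_nonneg fun _ => Real.iSup_nonneg fun _ => abs_nonneg _
  have hWn : 0 ≤ weylNorm f := Real.sqrt_nonneg _
  have hd1 : ∀ i, (1:ℝ) ≤ d i := fun i => by exact_mod_cast hd i
  have hdD : ∀ i, (d i : ℝ) ≤ D := fun i => by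
    rw [hD]; exact_mod_cast Finset.le_sup (f := d) (Finset.mem_univ i)
  have hD1 : (1:ℝ) ≤ D := (hd1 ⟨0, hq⟩).trans (hdD _)
  have hq1 : (1:ℝ) ≤ q := by exact_mod_cast hq
  let L : Fin q → {w : Fin (n + 1) → ℝ // vnorm w ≤ 1 ∧ ∑ j, w j * x j = 0} → ℝ :=
    fun i w => ∑ j, w.1 j * eval x (pderiv j (f i))
  have hs : sigmaMin d x f = wSig L (fun i => (d i : ℝ)⁻¹) := rfl
  have hh : sigmaMinHalf d x f = wSig L (fun i => (Real.sqrt (d i))⁻¹) := rfl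
  have hs0 : 0 ≤ sigmaMin d x f := hs ▸ wSig_nonneg _ _
  have hh0 : 0 ≤ sigmaMinHalf d x f := hh ▸ wSig_nonneg _ _
  have hsq : ∀ i, 1 ≤ Real.sqrt (d i) := fun i => Real.one_le_sqrt.2 (hd1 i)
  have hss : ∀ i, Real.sqrt (d i) * Real.sqrt (d i) = d i :=
    fun i => Real.mul_self_sqrt (by linarith [hd1 i])
  have key1 : sigmaMin d x f ≤ sigmaMinHalf d x f := by
    rw [hs, hh]
    have := wSig_le hq L (fun i => (Real.sqrt (d i))⁻¹) (fun i => (d i : ℝ)⁻¹) 1 one_pos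
      (fun i => inv_pos.2 (by linarith [hd1 i])) (fun i => by
        rw [one_mul]
        exact inv_anti₀ (by linarith [hsq i]) (by nlinarith [hsq i, hss i]))
    simpa using this
  have key2 : sigmaMinHalf d x f ≤ Real.sqrt D * sigmaMin d x f := by
    rw [hs, hh]
    refine wSig_le hq L _ _ _ (Real.sqrt_pos.2 (by linarith))
      (fun i => inv_pos.2 (by linarith [hsq i])) (fun i => ?_)
    have h1 : Real.sqrt (d i) ≤ Real.sqrt D := Real.sqrt_le_sqrt (hdD i)
    have h2 := hsq i
    rw [← div_eq_mul_inv, le_div_iff₀ (by linarith [hd1 i])]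
    calc (Real.sqrt (d i))⁻¹ * (d i : ℝ)
        = (Real.sqrt (d i))⁻¹ * (Real.sqrt (d i) * Real.sqrt (d i)) := by rw [hss]
      _ = Real.sqrt (d i) := inv_mul_cancel_left₀ (by linarith) _
      _ ≤ Real.sqrt D := h1
  have ha0 : 0 ≤ vnorm fun i => eval x (f i) := Real.sqrt_nonneg _
  generalize (vnorm fun i => eval x (f i)) = a at *
  generalize sigmaMin d x f = s at *
  generalize sigmaMinHalf d x f = h at *
  generalize polySupNorm f = P at *
  generalize weylNorm f = w at *
  have e : (Real.sqrt q * P / max a s) / (w / Real.sqrt (a ^ 2 + h ^ 2))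
      = (Real.sqrt q * Real.sqrt (a ^ 2 + h ^ 2) / max a s) * (P / w) := by
    rw [div_div_eq_mul_div]; ring
  have hPw : 0 ≤ P / w := div_nonneg hP hWn
  rw [e, mul_div_assoc (Real.sqrt (2 * q * D))]
  constructor
  · refine le_mul_of_one_le_left hPw ?_
    rw [one_le_div hΦ]
    have h1 : max a s ≤ Real.sqrt (a ^ 2 + h ^ 2) := by
      apply Real.le_sqrt_of_sq_le
      rcases max_cases a s with ⟨hm, _⟩ | ⟨hm, _⟩ <;> rw [hm] <;> nlinarith
    have h2 : 1 ≤ Real.sqrt q := Real.one_le_sqrt.2 hq1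
    nlinarith [Real.sqrt_nonneg (a ^ 2 + h ^ 2)]
  · refine mul_le_mul_of_nonneg_right ?_ hPw
    rw [div_le_iff₀ hΦ, ← Real.sqrt_mul (by linarith)]
    have hm0 := hΦ.le
    have ham : a ≤ max a s := le_max_left _ _
    have hsm : s ≤ max a s := le_max_right _ _
    generalize max a s = m at *
    rw [← Real.sqrt_sq hm0, ← Real.sqrt_mul (by positivity)]
    apply Real.sqrt_le_sqrt
    have h1 : h ^ 2 ≤ D * m ^ 2 := by
      calc h ^ 2 ≤ (Real.sqrt D * s) ^ 2 := pow_le_pow_left₀ hh0 key2 2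
        _ = D * s ^ 2 := by rw [mul_pow, Real.sq_sqrt (by linarith)]
        _ ≤ D * m ^ 2 := by gcongr
    have h2 : a ^ 2 ≤ D * m ^ 2 := by
      calc a ^ 2 ≤ m ^ 2 := pow_le_pow_left₀ ha0 ham 2
        _ ≤ D * m ^ 2 := le_mul_of_one_le_left (sq_nonneg m) hD1
    calc (q:ℝ) * (a ^ 2 + h ^ 2) ≤ q * (D * m ^ 2 + D * m ^ 2) := by gcongr
      _ = 2 * q * D * m ^ 2 := by ring
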